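/- If u ∈ E solves the fractional Ginzburg-Landau equation and Q₊(x) = max(u(x)² − 1, 0), then Q₊ satisfies (-Δ)^{α/2}Q₊(x) ≤ −2Q₊(x)² almost everywhere in ℝⁿ. -/

import Mathlib

open MeasureTheory Filter

/-- The fractional Laplacian `(-Δ)^{α/2}` with normalizing constant `C`,
defined as the principal-value singular integral. -/
noncomputable def fracLap (n : ℕ) (α C : ℝ)
    (u : EuclideanSpace ℝ (Fin n) → ℝ) (x : EuclideanSpace ℝ (Fin n)) : ℝ :=
  C * limUnder (nhdsWithin (0 : ℝ) (Set.Ioi 0)) (fun ε : ℝ =>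
    ∫ y in {y : EuclideanSpace ℝ (Fin n) | ε ≤ dist x y},
      (u x - u y) / dist x y ^ ((n : ℝ) + α))

/-- Membership in `E = C^{1,1}_loc(ℝⁿ) ∩ L_α`. -/
def MemE (n : ℕ) (α : ℝ) (u : EuclideanSpace ℝ (Fin n) → ℝ) : Prop :=
  Differentiable ℝ u ∧
  (∀ R : ℝ, ∃ K : NNReal, LipschitzOnWith K (fderiv ℝ u) (Metric.ball 0 R)) ∧
  Integrable (fun x : EuclideanSpace ℝ (Fin n) => |u x| / (1 + ‖x‖ ^ ((n : ℝ) + α)))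

section TruncatedOperator

/-- The kernel `‖z‖ ^ (-p)` cut off to the region `ε ≤ ‖z‖`. -/
noncomputable def truncKernel {E : Type*} [NormedAddCommGroup E] (p ε : ℝ) (z : E) : ℝ :=
  if ε ≤ ‖z‖ then ‖z‖ ^ (-p) else 0

/-- The integral operator with the truncated kernel. -/
noncomputable def truncLap {E : Type*} [NormedAddCommGroup E] [MeasureSpace E]
    (p ε : ℝ) (v : E → ℝ) (x : E) : ℝ :=
  ∫ z, truncKernel p ε z * (v x - v (x + z))

variable {E : Type*} [NormedAddCommGroup E]

lemma truncKernel_nonneg (p ε : ℝ) (z : E) : 0 ≤ truncKernel p ε z := by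
  unfold truncKernel
  split_ifs <;> positivity

lemma truncKernel_neg (p ε : ℝ) (z : E) : truncKernel p ε (-z) = truncKernel p ε z := by
  simp [truncKernel]

lemma continuous_one_add_norm_rpow (q : ℝ) : Continuous fun y : E ↦ (1 + ‖y‖) ^ q :=
  (continuous_const.add continuous_norm).rpow_const fun y ↦
    .inl (add_pos_of_pos_of_nonneg one_pos (norm_nonneg y)).ne'

lemma measurable_truncKernel [MeasurableSpace E] [BorelSpace E] (p ε : ℝ) :
    Measurable (truncKernel p ε : E → ℝ) := by
  unfold truncKernel
  exact Measurable.ite (measurableSet_le measurable_const measurable_norm)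
    (measurable_norm.pow_const _) measurable_const

lemma truncKernel_le {p ε : ℝ} (hp : 0 ≤ p) (hε : 0 < ε) {r : ℝ} {x : E} (hx : ‖x‖ ≤ r) (z : E) :
    truncKernel p ε z ≤ (1 + (1 + r) / ε) ^ p * (1 + ‖x + z‖) ^ (-p) := by
  have hr : 0 ≤ r := (norm_nonneg x).trans hx
  unfold truncKernel
  split_ifs with h
  · have hz : 0 < ‖z‖ := hε.trans_le h
    have ha : 0 < 1 + (1 + r) / ε := by positivity
    have h1 : 1 + ‖x + z‖ ≤ (1 + (1 + r) / ε) * ‖z‖ := by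
      have h2 : 1 + r ≤ (1 + r) / ε * ‖z‖ := by
        rw [div_mul_eq_mul_div, le_div_iff₀ hε]
        gcongr
      linarith [norm_add_le x z]
    calc ‖z‖ ^ (-p) = (1 + (1 + r) / ε) ^ p * ((1 + (1 + r) / ε) * ‖z‖) ^ (-p) := by
          rw [Real.mul_rpow ha.le hz.le, ← mul_assoc, ← Real.rpow_add ha]
          simp
      _ ≤ _ := by
          gcongr ?_ * ?_
          exact Real.rpow_le_rpow_of_nonpos (by positivity) h1 (by linarith)
  · positivity

lemma truncKernel_le_one {p ε : ℝ} (hp : 0 ≤ p) (hε : 0 < ε) (z : E) :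
    truncKernel p ε z ≤ (1 + 1 / ε) ^ p * (1 + ‖z‖) ^ (-p) := by
  simpa using truncKernel_le (x := (0 : E)) hp hε (r := 0) (by simp) z

lemma integrable_truncKernel_mul_comp_add [MeasureSpace E] [BorelSpace E]
    [(volume : Measure E).IsAddLeftInvariant] {p ε : ℝ} (hp : 0 ≤ p) (hε : 0 < ε) {v : E → ℝ}
    (hv : Continuous v) (hvi : Integrable fun y ↦ v y * (1 + ‖y‖) ^ (-p)) (x : E) :
    Integrable fun z ↦ truncKernel p ε z * v (x + z) := by
  refine ((hvi.comp_add_left x).norm.const_mul ((1 + (1 + ‖x‖) / ε) ^ p)).mono'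
    ((measurable_truncKernel p ε).mul (by fun_prop)).aestronglyMeasurable (.of_forall fun z ↦ ?_)
  rw [norm_mul, norm_mul, Real.norm_of_nonneg (truncKernel_nonneg p ε z),
    Real.norm_of_nonneg (by positivity : (0 : ℝ) ≤ (1 + ‖x + z‖) ^ (-p))]
  calc _ ≤ ((1 + (1 + ‖x‖) / ε) ^ p * (1 + ‖x + z‖) ^ (-p)) * ‖v (x + z)‖ := by
        gcongr
        exact truncKernel_le hp hε le_rfl z
    _ = _ := by ring

variable [NormedSpace ℝ E] [FiniteDimensional ℝ E] [MeasureSpace E] [BorelSpace E]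
  [(volume : Measure E).IsAddHaarMeasure]

lemma integrable_truncKernel {p ε : ℝ} (hp : (Module.finrank ℝ E : ℝ) < p) (hε : 0 < ε) :
    Integrable (truncKernel p ε : E → ℝ) := by
  have hp0 : 0 ≤ p := (Nat.cast_nonneg _).trans hp.le
  refine ((integrable_one_add_norm hp).const_mul ((1 + 1 / ε) ^ p)).mono'
    (measurable_truncKernel p ε).aestronglyMeasurable (.of_forall fun z ↦ ?_)
  rw [Real.norm_of_nonneg (truncKernel_nonneg p ε z)]
  exact truncKernel_le_one hp0 hε z

lemma integrable_truncLap_integrand {p ε : ℝ} (hp : (Module.finrank ℝ E : ℝ) < p) (hε : 0 < ε)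
    {v : E → ℝ} (hv : Continuous v) (hvi : Integrable fun y ↦ v y * (1 + ‖y‖) ^ (-p)) (x : E) :
    Integrable fun z ↦ truncKernel p ε z * (v x - v (x + z)) := by
  have hp0 : 0 ≤ p := (Nat.cast_nonneg _).trans hp.le
  simp_rw [mul_sub]
  exact ((integrable_truncKernel hp hε).mul_const _).sub
    (integrable_truncKernel_mul_comp_add hp0 hε hv hvi x)

lemma truncLap_eq_sub {p ε : ℝ} (hp : (Module.finrank ℝ E : ℝ) < p) (hε : 0 < ε)
    {v : E → ℝ} (hv : Continuous v) (hvi : Integrable fun y ↦ v y * (1 + ‖y‖) ^ (-p)) (x : E) :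
    truncLap p ε v x =
      (∫ z : E, truncKernel p ε z) * v x - ∫ y, truncKernel p ε (y - x) * v y := by
  have hp0 : 0 ≤ p := (Nat.cast_nonneg _).trans hp.le
  unfold truncLap
  simp_rw [mul_sub]
  rw [integral_sub ((integrable_truncKernel hp hε).mul_const _)
    (integrable_truncKernel_mul_comp_add hp0 hε hv hvi x), integral_mul_const,
    ← integral_add_left_eq_self (fun y ↦ truncKernel p ε (y - x) * v y) x]
  simp

/-- Symmetry of the truncated operator against compactly supported functions. -/
lemma integral_mul_truncLap_comm {p ε : ℝ} (hp : (Module.finrank ℝ E : ℝ) < p) (hε : 0 < ε)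
    {φ v : E → ℝ} (hφ : Continuous φ) (hφc : HasCompactSupport φ)
    (hv : Continuous v) (hvi : Integrable fun y ↦ v y * (1 + ‖y‖) ^ (-p)) :
    Integrable (fun x ↦ φ x * truncLap p ε v x) ∧ Integrable (fun x ↦ v x * truncLap p ε φ x) ∧
    ∫ x, φ x * truncLap p ε v x = ∫ x, v x * truncLap p ε φ x := by
  have hp0 : 0 ≤ p := (Nat.cast_nonneg _).trans hp.le
  have hwc : Continuous fun y : E ↦ (1 + ‖y‖) ^ (-p) :=
    continuous_one_add_norm_rpow (-p)
  have hφi : Integrable fun y ↦ φ y * (1 + ‖y‖) ^ (-p) :=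
    (hφ.mul hwc).integrable_of_hasCompactSupport hφc.mul_right
  obtain ⟨r, hr0, hr⟩ := hφc.isCompact.isBounded.exists_pos_norm_le
  have hF : Integrable (Function.uncurry fun x y : E ↦ φ x * truncKernel p ε (y - x) * v y)
      (volume.prod volume) := by
    have hm : Measurable (Function.uncurry fun x y : E ↦ φ x * truncKernel p ε (y - x) * v y) :=
      (((hφ.measurable.comp measurable_fst)).mul ((measurable_truncKernel p ε).comp
        (measurable_snd.sub measurable_fst))).mul (hv.measurable.comp measurable_snd)
    have hφ1 := (hφ.integrable_of_hasCompactSupport (μ := volume) hφc).norm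
    refine ((hφ1.mul_prod hvi.norm).const_mul ((1 + (1 + r) / ε) ^ p)).mono'
      hm.aestronglyMeasurable (.of_forall fun q ↦ ?_)
    obtain ⟨x, y⟩ := q
    simp only [Function.uncurry_apply_pair]
    rw [norm_mul, norm_mul, norm_mul, Real.norm_of_nonneg (truncKernel_nonneg p ε _),
      Real.norm_of_nonneg (by positivity : (0 : ℝ) ≤ (1 + ‖y‖) ^ (-p))]
    by_cases hx : x ∈ tsupport φ
    · have h := truncKernel_le hp0 hε (hr x hx) (y - x)
      rw [add_sub_cancel] at h
      calc _ ≤ ‖φ x‖ * ((1 + (1 + r) / ε) ^ p * (1 + ‖y‖) ^ (-p)) * ‖v y‖ := by gcongr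
        _ = _ := by ring
    · simp [image_eq_zero_of_notMem_tsupport hx]
  have hvφ : Integrable fun x ↦ φ x * v x :=
    (hφ.mul hv).integrable_of_hasCompactSupport hφc.mul_right
  set c := ∫ z : E, truncKernel p ε z
  have e1 (x : E) : φ x * truncLap p ε v x =
      c * (φ x * v x) - ∫ y, φ x * truncKernel p ε (y - x) * v y := by
    rw [truncLap_eq_sub hp hε hv hvi, mul_sub, ← integral_const_mul]
    simp only [mul_assoc]
    rw [mul_left_comm]
  have e2 (y : E) : v y * truncLap p ε φ y =
      c * (φ y * v y) - ∫ x, φ x * truncKernel p ε (y - x) * v y := by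
    rw [truncLap_eq_sub hp hε hφ hφi, mul_sub, ← integral_const_mul]
    congr 1
    · ring
    · congr 1 with x
      rw [← truncKernel_neg, neg_sub]
      ring
  have i1 : Integrable fun x ↦ ∫ y, φ x * truncKernel p ε (y - x) * v y := hF.integral_prod_left
  have i2 : Integrable fun y ↦ ∫ x, φ x * truncKernel p ε (y - x) * v y := hF.integral_prod_right
  refine ⟨?_, ?_, ?_⟩
  · simp_rw [e1]
    exact (hvφ.const_mul c).sub i1
  · simp_rw [e2]
    exact (hvφ.const_mul c).sub i2
  · simp_rw [e1, e2]
    rw [integral_sub (hvφ.const_mul c) i1, integral_sub (hvφ.const_mul c) i2,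
      integral_integral_swap hF]

lemma truncLap_comp_smul {p ε ρ : ℝ} (hρ : 0 < ρ) (v : E → ℝ) (x : E) :
    truncLap p ε (fun y ↦ v (ρ⁻¹ • y)) x =
      ρ ^ ((Module.finrank ℝ E : ℝ) - p) * truncLap p (ε / ρ) v (ρ⁻¹ • x) := by
  unfold truncLap
  have h := Measure.integral_comp_smul (volume : Measure E)
    (fun z ↦ truncKernel p ε z * (v (ρ⁻¹ • x) - v (ρ⁻¹ • (x + z)))) ρ
  have hk (z : E) : truncKernel p ε (ρ • z) = ρ ^ (-p) * truncKernel p (ε / ρ) z := by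
    unfold truncKernel
    simp only [norm_smul, Real.norm_of_nonneg hρ.le, div_le_iff₀' hρ,
      Real.mul_rpow hρ.le (norm_nonneg z)]
    split_ifs <;> simp
  simp only [smul_add, smul_smul, inv_mul_cancel₀ hρ.ne', one_smul, hk, mul_assoc,
    integral_const_mul] at h ⊢
  rw [abs_of_pos (by positivity), smul_eq_mul, eq_inv_mul_iff_mul_eq₀ (by positivity)] at h
  rw [← h, sub_eq_add_neg, Real.rpow_add hρ, Real.rpow_natCast, mul_assoc]

lemma integrable_norm_rpow_near {β : ℝ} (hβ : 0 < β) :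
    Integrable fun z : E ↦ if ‖z‖ < 1 then ‖z‖ ^ (β - Module.finrank ℝ E) else 0 := by
  rcases subsingleton_or_nontrivial E with hE | hE
  · have : CompactSpace E := Finite.compactSpace
    exact Integrable.of_finite
  · rw [integrable_fun_norm_addHaar (volume : Measure E)
      (f := fun r ↦ if r < 1 then r ^ (β - Module.finrank ℝ E) else 0)]
    have hd : 0 < Module.finrank ℝ E := Module.finrank_pos
    have h1 := (intervalIntegral.integrableOn_Ioo_rpow_iff (s := β - 1) one_pos).2 (by linarith)
    rw [← integrable_indicator_iff measurableSet_Ioo] at h1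
    refine h1.integrableOn.congr_fun (fun r hr ↦ ?_) measurableSet_Ioi
    have hr0 : 0 < r := hr
    by_cases hr1 : r < 1
    · simp only [Set.indicator, Set.mem_Ioo, hr0, hr1, and_self, if_true, smul_eq_mul]
      rw [← Real.rpow_natCast, ← Real.rpow_add hr0, Nat.cast_pred hd]
      congr 1
      ring
    · simp [hr1]

/-- The contribution of a small annulus at a point where the function has a quadratic
remainder. -/
lemma abs_truncLap_sub_le {p β M ε ε' : ℝ} (hp : (Module.finrank ℝ E : ℝ) < p) (hβ : 0 < β)
    (hpβ : 2 - p = 2 * β - Module.finrank ℝ E) (hε' : 0 < ε') (hεε' : ε' ≤ ε) (hε1 : ε ≤ 1)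
    (hM : 0 ≤ M) {v : E → ℝ} (hv : Continuous v)
    (hvi : Integrable fun y ↦ v y * (1 + ‖y‖) ^ (-p)) {x : E} (L : E →L[ℝ] ℝ)
    (hL : ∀ z, ‖z‖ < 1 → |v (x + z) - v x - L z| ≤ M * ‖z‖ ^ 2) :
    |truncLap p ε' v x - truncLap p ε v x| ≤
      M * (∫ z : E, if ‖z‖ < 1 then ‖z‖ ^ (β - Module.finrank ℝ E) else 0) * ε ^ β := by
  have hε : 0 < ε := hε'.trans_le hεε'
  set D : E → ℝ := fun z ↦ truncKernel p ε' z - truncKernel p ε z with hD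
  have hDeq (z : E) : D z = if ε' ≤ ‖z‖ ∧ ‖z‖ < ε then ‖z‖ ^ (-p) else 0 := by
    simp only [hD, truncKernel]
    by_cases h1 : ε ≤ ‖z‖
    · simp [h1, hεε'.trans h1, h1.not_gt]
    · simp [h1, not_le.1 h1]
  have hDi : Integrable D := (integrable_truncKernel hp hε').sub (integrable_truncKernel hp hε)
  have hDL : Integrable fun z ↦ D z * L z := by
    refine (hDi.norm.mul_const ‖L‖).mono'
      (hDi.aestronglyMeasurable.mul L.continuous.aestronglyMeasurable) (.of_forall fun z ↦ ?_)
    rw [norm_mul, hDeq]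
    split_ifs with h
    · gcongr
      exact (L.le_opNorm z).trans (mul_le_of_le_one_right (norm_nonneg L) (h.2.le.trans hε1))
    · simp
  have hodd : ∫ z, D z * L z = 0 := by
    have h := integral_neg_eq_self (fun z ↦ D z * L z) (volume : Measure E)
    simp only [hD, truncKernel_neg, map_neg, mul_neg, integral_neg] at h ⊢
    linarith
  have hi' := integrable_truncLap_integrand hp hε' hv hvi x
  have hi := integrable_truncLap_integrand hp hε hv hvi x
  have hsub : Integrable fun z ↦ D z * (v x - v (x + z)) := by
    simp only [hD, sub_mul]
    exact hi'.sub hi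
  have hrep : truncLap p ε' v x - truncLap p ε v x = ∫ z, D z * (v x - v (x + z) + L z) := by
    simp only [mul_add]
    rw [integral_add hsub hDL, hodd, add_zero, truncLap, truncLap, ← integral_sub hi' hi]
    simp only [hD, sub_mul]
  rw [hrep, mul_right_comm, ← integral_const_mul, ← Real.norm_eq_abs]
  refine norm_integral_le_of_norm_le ((integrable_norm_rpow_near hβ).const_mul _)
    (.of_forall fun z ↦ ?_)
  rw [norm_mul, hDeq]
  by_cases h : ε' ≤ ‖z‖ ∧ ‖z‖ < ε
  · have hz : 0 < ‖z‖ := hε'.trans_le h.1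
    have hz1 : ‖z‖ < 1 := h.2.trans_le hε1
    rw [if_pos h, if_pos hz1, Real.norm_of_nonneg (by positivity)]
    have h2 : ‖v x - v (x + z) + L z‖ ≤ M * ‖z‖ ^ 2 := by
      rw [Real.norm_eq_abs, ← abs_neg]
      convert hL z hz1 using 2
      ring
    calc ‖z‖ ^ (-p) * ‖v x - v (x + z) + L z‖ ≤ ‖z‖ ^ (-p) * (M * ‖z‖ ^ 2) := by gcongr
      _ = M * (‖z‖ ^ β * ‖z‖ ^ (β - Module.finrank ℝ E)) := by
        rw [← Real.rpow_add hz, mul_left_comm, ← Real.rpow_natCast, ← Real.rpow_add hz]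
        congr 2
        push_cast
        linarith
      _ ≤ M * (ε ^ β * ‖z‖ ^ (β - Module.finrank ℝ E)) := by
        gcongr
        exact h.2.le
      _ = _ := by ring
  · rw [if_neg h]
    simp only [norm_zero, zero_mul]
    split_ifs <;> positivity

lemma exists_tendsto_of_abs_sub_le_rpow {f : ℝ → ℝ} {B β : ℝ} (hβ : 0 < β)
    (hf : ∀ ε' ε, 0 < ε' → ε' ≤ ε → ε ≤ 1 → |f ε' - f ε| ≤ B * ε ^ β) :
    ∃ l, Tendsto f (nhdsWithin 0 (Set.Ioi 0)) (nhds l) ∧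
      ∀ ε, 0 < ε → ε ≤ 1 → |l - f ε| ≤ B * ε ^ β := by
  have h0 : Tendsto (fun ε : ℝ ↦ B * ε ^ β) (nhdsWithin 0 (Set.Ioi 0)) (nhds 0) := by
    have h : ContinuousAt (fun ε : ℝ ↦ B * ε ^ β) 0 :=
      continuousAt_const.mul (Real.continuousAt_rpow_const _ _ (.inr hβ.le))
    have := h.tendsto.mono_left (nhdsWithin_le_nhds (s := Set.Ioi 0))
    simpa [Real.zero_rpow hβ.ne'] using this
  have hcauchy : Cauchy (Filter.map f (nhdsWithin 0 (Set.Ioi 0))) := by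
    rw [Metric.cauchy_iff]
    refine ⟨inferInstance, fun e he ↦ ?_⟩
    have hev := (h0.eventually (gt_mem_nhds (half_pos he))).and
      (Ioc_mem_nhdsGT (zero_lt_one' ℝ))
    obtain ⟨δ, hδ, hδ0, hδ1⟩ := hev.exists
    refine ⟨f '' Set.Ioc 0 δ, Filter.image_mem_map (Ioc_mem_nhdsGT hδ0), ?_⟩
    rintro _ ⟨a, ha, rfl⟩ _ ⟨b, hb, rfl⟩
    have h1 := hf a δ ha.1 ha.2 hδ1
    have h2 := hf b δ hb.1 hb.2 hδ1
    rw [abs_sub_comm] at h2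
    rw [Real.dist_eq]
    linarith [abs_sub_le (f a) (f δ) (f b)]
  obtain ⟨l, hl⟩ := cauchy_map_iff_exists_tendsto.1 hcauchy
  refine ⟨l, hl, fun ε hε hε1 ↦ ?_⟩
  refine le_of_tendsto ((hl.sub_const (f ε)).abs) ?_
  filter_upwards [Ioc_mem_nhdsGT hε] with a ha using hf a ε ha.1 ha.2 hε1

lemma abs_sub_sub_fderiv_le {F : Type*} [NormedAddCommGroup F] [NormedSpace ℝ F] {v : F → ℝ}
    (hd : Differentiable ℝ v) {M : NNReal} {s : Set F} (hM : LipschitzOnWith M (fderiv ℝ v) s)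
    {x z : F} (hs : Metric.closedBall x ‖z‖ ⊆ s) :
    |v (x + z) - v x - fderiv ℝ v x z| ≤ M * ‖z‖ ^ 2 := by
  have hx : x ∈ Metric.closedBall x ‖z‖ := by simp
  have h := (convex_closedBall x ‖z‖).norm_image_sub_le_of_norm_fderiv_le' (𝕜 := ℝ)
    (f := v) (x := x) (y := x + z) (φ := fderiv ℝ v x) (C := M * ‖z‖)
    (fun y _ ↦ hd y) (fun y hy ↦ ?_) hx (by simp)
  · rw [add_sub_cancel_left, Real.norm_eq_abs] at h
    exact h.trans_eq (by ring)
  · refine (hM.norm_sub_le (hs hy) (hs hx)).trans ?_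
    gcongr
    exact mem_closedBall_iff_norm.1 hy

/-- Decay of the truncated operator applied to a smooth bump, uniformly in the truncation. -/
lemma exists_abs_truncLap_bump_le [HasContDiffBump E] {p β : ℝ}
    (hp : (Module.finrank ℝ E : ℝ) < p) (hβ : 0 < β)
    (hpβ : 2 - p = 2 * β - Module.finrank ℝ E) (η : ContDiffBump (0 : E)) :
    ∃ A, ∀ ε x, 0 < ε → ε ≤ 1 → |truncLap p ε η x| ≤ A * (1 + ‖x‖) ^ (-p) := by
  have hp0 : 0 ≤ p := (Nat.cast_nonneg _).trans hp.le
  have hη : ContDiff ℝ 2 (η : E → ℝ) := η.contDiff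
  have hηc : HasCompactSupport (η : E → ℝ) := η.hasCompactSupport
  have hwc : Continuous fun y : E ↦ (1 + ‖y‖) ^ (-p) :=
    continuous_one_add_norm_rpow (-p)
  have hηi : Integrable fun y ↦ η y * (1 + ‖y‖) ^ (-p) :=
    (η.continuous.mul hwc).integrable_of_hasCompactSupport hηc.mul_right
  obtain ⟨M, hM⟩ := ContDiff.lipschitzWith_of_hasCompactSupport (n := 1) (hηc.fderiv ℝ)
    (hη.fderiv_right (by norm_num)) (by norm_num)
  set H := ∫ z : E, if ‖z‖ < 1 then ‖z‖ ^ (β - Module.finrank ℝ E) else 0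
  set c := ∫ z : E, truncKernel p 1 z
  set I := ∫ z : E, η z
  set r := η.rOut
  have hr : 0 < r := η.rOut_pos
  have hc : 0 ≤ c := integral_nonneg fun z ↦ truncKernel_nonneg p 1 z
  have hI : 0 ≤ I := integral_nonneg fun z ↦ η.nonneg
  have hH : 0 ≤ H := integral_nonneg fun z ↦ by dsimp only; split_ifs <;> positivity
  refine ⟨I * (2 + 1 / r) ^ p + (c + M * H) * (1 + 2 * r) ^ p, fun ε x hε hε1 ↦ ?_⟩
  rw [add_mul]
  rcases le_or_gt (2 * r) ‖x‖ with hx | hx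
  · have hx0 : 0 < ‖x‖ := by linarith
    have hηx : η x = 0 := η.zero_of_le_dist (by rw [dist_zero_right]; change r ≤ _; linarith)
    have hker : (‖x‖ / 2) ^ (-p) ≤ (2 + 1 / r) ^ p * (1 + ‖x‖) ^ (-p) := by
      have ha : 0 < 2 + 1 / r := by positivity
      have h1 : 1 + ‖x‖ ≤ (2 + 1 / r) * (‖x‖ / 2) := by
        have : 1 ≤ 1 / r * (‖x‖ / 2) := by
          rw [one_div_mul_eq_div, le_div_iff₀ hr]
          linarith
        linarith
      calc (‖x‖ / 2) ^ (-p) = (2 + 1 / r) ^ p * ((2 + 1 / r) * (‖x‖ / 2)) ^ (-p) := by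
            rw [Real.mul_rpow ha.le (by positivity), ← mul_assoc, ← Real.rpow_add ha]
            simp
        _ ≤ _ := by
            gcongr ?_ * ?_
            exact Real.rpow_le_rpow_of_nonpos (by positivity) h1 (by linarith)
    have hmain : |truncLap p ε η x| ≤ (‖x‖ / 2) ^ (-p) * I := by
      rw [truncLap_eq_sub hp hε η.continuous hηi, hηx, mul_zero, zero_sub, abs_neg,
        ← integral_const_mul, ← Real.norm_eq_abs]
      refine norm_integral_le_of_norm_le
        ((η.continuous.integrable_of_hasCompactSupport hηc).const_mul _) (.of_forall fun y ↦ ?_)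
      rw [norm_mul, Real.norm_of_nonneg (truncKernel_nonneg p ε _), Real.norm_of_nonneg η.nonneg]
      by_cases hy : ‖y‖ < r
      · gcongr
        · exact η.nonneg
        have hxy : ‖x‖ / 2 ≤ ‖y - x‖ := by
          rw [norm_sub_rev]
          linarith [norm_sub_norm_le x y]
        unfold truncKernel
        split_ifs
        · exact Real.rpow_le_rpow_of_nonpos (by positivity) hxy (by linarith)
        · positivity
      · rw [η.zero_of_le_dist (by simpa using hy)]
        simp
    calc |truncLap p ε η x| ≤ (2 + 1 / r) ^ p * (1 + ‖x‖) ^ (-p) * I := by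
          refine hmain.trans ?_
          gcongr
      _ = I * (2 + 1 / r) ^ p * (1 + ‖x‖) ^ (-p) := by ring
      _ ≤ _ := le_add_of_nonneg_right (by positivity)
  · have hone : 1 ≤ (1 + 2 * r) ^ p * (1 + ‖x‖) ^ (-p) := by
      rw [Real.rpow_neg (by positivity), ← div_eq_mul_inv, one_le_div (by positivity)]
      gcongr
    have h1 : |truncLap p 1 η x| ≤ c := by
      rw [truncLap, ← Real.norm_eq_abs]
      refine norm_integral_le_of_norm_le (integrable_truncKernel hp one_pos)
        (.of_forall fun z ↦ ?_)
      rw [norm_mul, Real.norm_of_nonneg (truncKernel_nonneg p 1 z)]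
      refine mul_le_of_le_one_right (truncKernel_nonneg p 1 z) ?_
      rw [Real.norm_eq_abs, abs_le]
      constructor <;> linarith [η.nonneg (x := x), η.nonneg (x := x + z), η.le_one (x := x),
        η.le_one (x := x + z)]
    have h2 := abs_truncLap_sub_le hp hβ hpβ hε hε1 le_rfl M.2 η.continuous hηi
      (fderiv ℝ η x) fun z _ ↦ abs_sub_sub_fderiv_le (hη.differentiable (by norm_num))
        (hM.lipschitzOnWith (s := Set.univ)) (Set.subset_univ _)
    rw [Real.one_rpow, mul_one] at h2
    have h3 : |truncLap p ε η x| ≤ c + M * H := by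
      have := abs_sub_abs_le_abs_sub (truncLap p ε η x) (truncLap p 1 η x)
      change _ ≤ (M : ℝ) * H at h2
      linarith
    calc |truncLap p ε η x| ≤ (c + M * H) * ((1 + 2 * r) ^ p * (1 + ‖x‖) ^ (-p)) :=
          h3.trans (le_mul_of_one_le_right (by positivity) hone)
      _ = (c + M * H) * (1 + 2 * r) ^ p * (1 + ‖x‖) ^ (-p) := by ring
      _ ≤ _ := le_add_of_nonneg_left (by positivity)

/-- A nonnegative function of finite weighted mass vanishes if its mass on every large ball is
controlled by the weighted mass adapted to that ball: sum the bounds over dyadic radii. -/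
lemma eq_zero_of_setIntegral_closedBall_le {p A : ℝ} (hp : (Module.finrank ℝ E : ℝ) < p)
    (hA : 0 ≤ A) {v : E → ℝ} (hv : Continuous v) (hv0 : ∀ x, 0 ≤ v x)
    (hvi : ∀ ρ : ℝ, 1 ≤ ρ → Integrable fun y ↦ v y * (ρ + ‖y‖) ^ (-p))
    (h : ∀ ρ : ℝ, 1 ≤ ρ → ∫ x in Metric.closedBall 0 ρ, v x ≤
      A * ρ ^ (Module.finrank ℝ E : ℝ) * ∫ x, v x * (ρ + ‖x‖) ^ (-p)) :
    v = 0 := by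
  set d : ℝ := (Module.finrank ℝ E : ℝ)
  have hp0 : 0 ≤ p := (Nat.cast_nonneg _).trans hp.le
  have hq0 : (0 : ℝ) < 2 ^ (d - p) := by positivity
  have hq1 : (2 : ℝ) ^ (d - p) < 1 := Real.rpow_lt_one_of_one_lt_of_neg one_lt_two (by linarith)
  obtain ⟨R, hR, hR1⟩ : ∃ R : ℝ,
      2 ^ p * A * R ^ (-(p - d)) * (1 - 2 ^ (d - p))⁻¹ ≤ 1 / 2 ∧ 1 ≤ R := by
    have ht := ((tendsto_rpow_neg_atTop (sub_pos.2 hp)).const_mul (2 ^ p * A)).mul_const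
      (1 - (2 : ℝ) ^ (d - p))⁻¹
    rw [mul_zero, zero_mul] at ht
    exact ((ht.eventually (ge_mem_nhds (by norm_num : (0 : ℝ) < 1 / 2))).and
      (eventually_ge_atTop 1)).exists
  have hR0 : 0 < R := one_pos.trans_le hR1
  set G := ∫ x, v x * (R + ‖x‖) ^ (-p) with hG
  have hnn (ρ : ℝ) (hρ : 0 < ρ) (x : E) : 0 ≤ v x * (ρ + ‖x‖) ^ (-p) :=
    mul_nonneg (hv0 x) (by positivity)
  have hG0 : 0 ≤ G := integral_nonneg (hnn R hR0)
  have hrad (i : ℕ) : 1 ≤ R * 2 ^ i := one_le_mul_of_one_le_of_one_le hR1 (one_le_pow₀ one_le_two)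
  have hball (i : ℕ) : IntegrableOn v (Metric.closedBall 0 (R * 2 ^ i)) :=
    hv.continuousOn.integrableOn_compact (isCompact_closedBall _ _)
  let f (i : ℕ) : E → ℝ := (Metric.closedBall 0 (R * 2 ^ i)).indicator
    fun x ↦ 2 ^ p * (R * 2 ^ i) ^ (-p) * v x
  have hf0 (i : ℕ) (x : E) : 0 ≤ f i x := Set.indicator_nonneg (fun y _ ↦ by
    have := hv0 y
    positivity) x
  have hfi (i : ℕ) : Integrable (f i) :=
    IntegrableOn.integrable_indicator ((hball i).const_mul _) Metric.isClosed_closedBall.measurableSet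
  have hdom (x : E) : ENNReal.ofReal (v x * (R + ‖x‖) ^ (-p)) ≤ ∑' i, ENNReal.ofReal (f i x) := by
    obtain ⟨i, hi1, hi2⟩ := exists_nat_pow_near (x := (R + ‖x‖) / R) (y := 2)
      (by rw [one_le_div hR0]; linarith [norm_nonneg x]) one_lt_two
    rw [le_div_iff₀ hR0] at hi1
    rw [div_lt_iff₀ hR0] at hi2
    refine le_trans (ENNReal.ofReal_le_ofReal ?_) (ENNReal.le_tsum (i + 1))
    have hx : x ∈ Metric.closedBall (0 : E) (R * 2 ^ (i + 1)) := by
      rw [mem_closedBall_zero_iff]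
      linarith
    have hle : R * 2 ^ (i + 1) ≤ 2 * (R + ‖x‖) := by
      rw [pow_succ]
      linarith
    simp only [f, Set.indicator_of_mem hx]
    rw [mul_comm (v x)]
    refine mul_le_mul_of_nonneg_right ?_ (hv0 x)
    calc (R + ‖x‖) ^ (-p) = 2 ^ p * (2 * (R + ‖x‖)) ^ (-p) := by
          rw [Real.mul_rpow two_pos.le (by positivity), ← mul_assoc, ← Real.rpow_add two_pos]
          simp
      _ ≤ _ := by
          gcongr ?_ * ?_
          exact Real.rpow_le_rpow_of_nonpos (by positivity) hle (by linarith)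
  have hterm (i : ℕ) : ∫ x, f i x ≤ 2 ^ p * A * R ^ (-(p - d)) * G * (2 ^ (d - p)) ^ i := by
    have hρ : 0 < R * 2 ^ i := one_pos.trans_le (hrad i)
    simp only [f]
    rw [integral_indicator Metric.isClosed_closedBall.measurableSet, integral_const_mul]
    have hmono : ∫ x, v x * (R * 2 ^ i + ‖x‖) ^ (-p) ≤ G := by
      refine integral_mono (hvi _ (hrad i)) (hvi R hR1) fun x ↦ ?_
      refine mul_le_mul_of_nonneg_left ?_ (hv0 x)
      refine Real.rpow_le_rpow_of_nonpos (by positivity) ?_ (by linarith)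
      gcongr
      exact le_mul_of_one_le_right hR0.le (one_le_pow₀ one_le_two)
    calc _ ≤ 2 ^ p * (R * 2 ^ i) ^ (-p) * (A * (R * 2 ^ i) ^ d * G) := by
          gcongr
          refine (h _ (hrad i)).trans ?_
          gcongr
      _ = 2 ^ p * A * G * ((R * 2 ^ i) ^ (-p) * (R * 2 ^ i) ^ d) := by ring
      _ = 2 ^ p * A * G * (R ^ (-(p - d)) * (2 ^ (d - p)) ^ i) := by
          rw [← Real.rpow_add hρ, Real.mul_rpow hR0.le (by positivity), neg_sub,
            neg_add_eq_sub, ← Real.rpow_natCast, ← Real.rpow_natCast, ← Real.rpow_mul two_pos.le,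
            ← Real.rpow_mul two_pos.le, mul_comm (i : ℝ)]
      _ = _ := by ring
  have hsum : Summable fun i : ℕ ↦ 2 ^ p * A * R ^ (-(p - d)) * G * ((2 : ℝ) ^ (d - p)) ^ i :=
    (summable_geometric_of_lt_one hq0.le hq1).mul_left _
  have hkey : ENNReal.ofReal G ≤ ENNReal.ofReal (1 / 2 * G) := by
    calc ENNReal.ofReal G = ∫⁻ x, ENNReal.ofReal (v x * (R + ‖x‖) ^ (-p)) :=
          ofReal_integral_eq_lintegral_ofReal (hvi R hR1) (.of_forall (hnn R hR0))
      _ ≤ ∫⁻ x, ∑' i, ENNReal.ofReal (f i x) := lintegral_mono hdom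
      _ = ∑' i, ∫⁻ x, ENNReal.ofReal (f i x) :=
          lintegral_tsum fun i ↦ (hfi i).aemeasurable.ennreal_ofReal
      _ = ∑' i, ENNReal.ofReal (∫ x, f i x) := by
          congr 1 with i
          rw [ofReal_integral_eq_lintegral_ofReal (hfi i) (.of_forall (hf0 i))]
      _ ≤ ∑' i, ENNReal.ofReal (2 ^ p * A * R ^ (-(p - d)) * G * (2 ^ (d - p)) ^ i) :=
          ENNReal.tsum_le_tsum fun i ↦ ENNReal.ofReal_le_ofReal (hterm i)
      _ = ENNReal.ofReal (2 ^ p * A * R ^ (-(p - d)) * (1 - 2 ^ (d - p))⁻¹ * G) := by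
          rw [← ENNReal.ofReal_tsum_of_nonneg (fun i ↦ by positivity) hsum, tsum_mul_left,
            tsum_geometric_of_lt_one hq0.le hq1]
          ring_nf
      _ ≤ _ := ENNReal.ofReal_le_ofReal (by gcongr)
  rw [ENNReal.ofReal_le_ofReal_iff (by positivity)] at hkey
  have hGz : G = 0 := by linarith
  rw [hG, integral_eq_zero_iff_of_nonneg (hnn R hR0) (hvi R hR1)] at hGz
  refine (hv.ae_eq_iff_eq volume continuous_zero).1 ?_
  filter_upwards [hGz] with x hx
  have hpos : 0 < (R + ‖x‖) ^ (-p) := by positivity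
  simpa [hpos.ne'] using hx

/-- A Liouville theorem for nonnegative solutions of `(-Δ)^{s} v ≤ -κ v`, where the inequality
holds for the truncated operators with a locally uniform error. -/
lemma eq_zero_of_truncLap_le [HasContDiffBump E] {p β κ : ℝ}
    (hp : (Module.finrank ℝ E : ℝ) < p) (hβ : 0 < β)
    (hpβ : 2 - p = 2 * β - Module.finrank ℝ E) (hκ : 0 < κ) {v : E → ℝ} (hv : Continuous v)
    (hv0 : ∀ x, 0 ≤ v x) (hvi : Integrable fun y ↦ v y * (1 + ‖y‖) ^ (-p))
    (h : ∀ R : ℝ, ∃ B : ℝ, ∀ x, ‖x‖ < R → ∀ ε, 0 < ε → ε ≤ 1 →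
      truncLap p ε v x ≤ -κ * v x + B * ε ^ β) :
    v = 0 := by
  have hp0 : 0 ≤ p := (Nat.cast_nonneg _).trans hp.le
  have hvi' (ρ : ℝ) (hρ : 1 ≤ ρ) : Integrable fun y ↦ v y * (ρ + ‖y‖) ^ (-p) := by
    have hρ0 : 0 < ρ := one_pos.trans_le hρ
    refine hvi.mono' (hv.mul ((continuous_const.add continuous_norm).rpow_const fun y ↦
      .inl (add_pos_of_pos_of_nonneg hρ0 (norm_nonneg y)).ne')).aestronglyMeasurable
      (.of_forall fun y ↦ ?_)
    rw [Real.norm_of_nonneg (mul_nonneg (hv0 y) (by positivity))]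
    refine mul_le_mul_of_nonneg_left ?_ (hv0 y)
    exact Real.rpow_le_rpow_of_nonpos (by positivity) (by gcongr) (by linarith)
  let η : ContDiffBump (0 : E) := ⟨1, 2, one_pos, one_lt_two⟩
  obtain ⟨A, hA⟩ := exists_abs_truncLap_bump_le hp hβ hpβ η
  have hA0 : 0 ≤ A := by
    have := (abs_nonneg _).trans (hA 1 0 one_pos le_rfl)
    simpa using this
  refine eq_zero_of_setIntegral_closedBall_le hp (A := κ⁻¹ * A) (by positivity) hv hv0 hvi'
    fun ρ hρ ↦ ?_
  have hρ0 : 0 < ρ := one_pos.trans_le hρ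
  set φ : E → ℝ := fun x ↦ η (ρ⁻¹ • x) with hφ
  have hφcont : Continuous φ := η.continuous.comp (continuous_const_smul _)
  have hφc : HasCompactSupport φ := η.hasCompactSupport.comp_smul (inv_ne_zero hρ0.ne')
  have hφv : Integrable fun x ↦ φ x * v x :=
    (hφcont.mul hv).integrable_of_hasCompactSupport hφc.mul_right
  have hφi : Integrable φ := hφcont.integrable_of_hasCompactSupport hφc
  obtain ⟨B, hB⟩ := h (2 * ρ)
  set G := ∫ x, v x * (ρ + ‖x‖) ^ (-p) with hG
  have htest : κ * ∫ x, φ x * v x ≤ A * ρ ^ (Module.finrank ℝ E : ℝ) * G := by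
    have hε (ε : ℝ) (hε0 : 0 < ε) (hε1 : ε ≤ 1) : κ * (∫ x, φ x * v x) - (∫ x, φ x) * (B * ε ^ β) ≤
        A * ρ ^ (Module.finrank ℝ E : ℝ) * G := by
      obtain ⟨i1, i2, heq⟩ := integral_mul_truncLap_comm hp hε0 hφcont hφc hv hvi
      have hup : ∫ x, φ x * truncLap p ε v x ≤
          -κ * (∫ x, φ x * v x) + (∫ x, φ x) * (B * ε ^ β) := by
        rw [← integral_const_mul, ← integral_mul_const,
          ← integral_add (hφv.const_mul _) (hφi.mul_const _)]
        refine integral_mono i1 ((hφv.const_mul _).add (hφi.mul_const _)) fun x ↦ ?_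
        by_cases hx : ‖x‖ < 2 * ρ
        · calc φ x * truncLap p ε v x ≤ φ x * (-κ * v x + B * ε ^ β) :=
                mul_le_mul_of_nonneg_left (hB x hx ε hε0 hε1) η.nonneg
            _ = _ := by ring
        · have : φ x = 0 := η.zero_of_le_dist (by
            rw [dist_zero_right, norm_smul, norm_inv, Real.norm_of_nonneg hρ0.le,
              inv_mul_eq_div, le_div_iff₀ hρ0]
            exact not_lt.1 hx)
          simp [this]
      have hlow : -(A * ρ ^ (Module.finrank ℝ E : ℝ) * G) ≤ ∫ x, v x * truncLap p ε φ x := by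
        rw [hG, ← integral_const_mul, ← integral_neg]
        refine integral_mono ((hvi' ρ hρ).const_mul _).neg i2 fun x ↦ ?_
        have hb := (abs_le.1 (hA (ε / ρ) (ρ⁻¹ • x) (by positivity)
          ((div_le_one hρ0).2 (hε1.trans hρ)))).1
        have hw : (1 + ‖ρ⁻¹ • x‖) ^ (-p) = ρ ^ p * (ρ + ‖x‖) ^ (-p) := by
          have : 1 + ‖ρ⁻¹ • x‖ = ρ⁻¹ * (ρ + ‖x‖) := by
            rw [norm_smul, norm_inv, Real.norm_of_nonneg hρ0.le]
            field_simp
          rw [this, Real.mul_rpow (by positivity) (by positivity), Real.inv_rpow hρ0.le,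
            Real.rpow_neg hρ0.le, inv_inv]
        dsimp only
        rw [hφ, truncLap_comp_smul hρ0]
        calc -(A * ρ ^ (Module.finrank ℝ E : ℝ) * (v x * (ρ + ‖x‖) ^ (-p)))
            = v x * (ρ ^ ((Module.finrank ℝ E : ℝ) - p) * -(A * (1 + ‖ρ⁻¹ • x‖) ^ (-p))) := by
              rw [hw, Real.rpow_sub hρ0]
              field_simp
          _ ≤ _ := mul_le_mul_of_nonneg_left (mul_le_mul_of_nonneg_left hb (by positivity)) (hv0 x)
      rw [← heq] at hlow
      linarith
    have hlim : Tendsto (fun ε : ℝ ↦ κ * (∫ x, φ x * v x) - (∫ x, φ x) * (B * ε ^ β))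
        (nhdsWithin 0 (Set.Ioi 0)) (nhds (κ * ∫ x, φ x * v x)) := by
      have hc : ContinuousAt
          (fun ε : ℝ ↦ κ * (∫ x, φ x * v x) - (∫ x, φ x) * (B * ε ^ β)) 0 :=
        continuousAt_const.sub (continuousAt_const.mul
          (continuousAt_const.mul (Real.continuousAt_rpow_const _ _ (.inr hβ.le))))
      have := hc.tendsto.mono_left (nhdsWithin_le_nhds (s := Set.Ioi 0))
      simpa [Real.zero_rpow hβ.ne'] using this
    refine le_of_tendsto hlim ?_
    filter_upwards [Ioc_mem_nhdsGT (zero_lt_one' ℝ)] with ε he using hε ε he.1 he.2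
  have hset : ∫ x in Metric.closedBall 0 ρ, v x ≤ ∫ x, φ x * v x := by
    rw [← integral_indicator Metric.isClosed_closedBall.measurableSet]
    refine integral_mono ((hv.continuousOn.integrableOn_compact
      (isCompact_closedBall _ _)).integrable_indicator Metric.isClosed_closedBall.measurableSet)
      hφv fun x ↦ Set.indicator_le' (fun y hy ↦ ?_) (fun y _ ↦ mul_nonneg η.nonneg (hv0 y)) x
    have : φ y = 1 := η.one_of_mem_closedBall (by
      rw [mem_closedBall_zero_iff, norm_smul, norm_inv, Real.norm_of_nonneg hρ0.le,
        inv_mul_eq_div, div_le_iff₀ hρ0]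
      change _ ≤ 1 * ρ
      simpa using hy)
    change v y ≤ φ y * v y
    rw [this, one_mul]
  calc _ ≤ κ⁻¹ * (κ * ∫ x, φ x * v x) := by rwa [inv_mul_cancel_left₀ hκ.ne']
    _ ≤ κ⁻¹ * (A * ρ ^ (Module.finrank ℝ E : ℝ) * G) := by gcongr
    _ = _ := by ring

lemma truncLap_le_mul_truncLap {p ε s : ℝ} (hp : (Module.finrank ℝ E : ℝ) < p) (hε : 0 < ε)
    {u v : E → ℝ} (hu : Continuous u) (hui : Integrable fun y ↦ u y * (1 + ‖y‖) ^ (-p))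
    (hv : Continuous v) (hvi : Integrable fun y ↦ v y * (1 + ‖y‖) ^ (-p)) {x : E}
    (h : ∀ y, v x - v y ≤ s * (u x - u y)) :
    truncLap p ε v x ≤ s * truncLap p ε u x := by
  rw [truncLap, truncLap, ← integral_const_mul]
  refine integral_mono (integrable_truncLap_integrand hp hε hv hvi x)
    ((integrable_truncLap_integrand hp hε hu hui x).const_mul s) fun z ↦ ?_
  calc _ ≤ truncKernel p ε z * (s * (u x - u (x + z))) :=
        mul_le_mul_of_nonneg_left (h _) (truncKernel_nonneg p ε z)
    _ = _ := by ring

end TruncatedOperator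

lemma setIntegral_eq_truncLap (n : ℕ) {p ε : ℝ} (u : EuclideanSpace ℝ (Fin n) → ℝ)
    (x : EuclideanSpace ℝ (Fin n)) :
    ∫ y in {y : EuclideanSpace ℝ (Fin n) | ε ≤ dist x y}, (u x - u y) / dist x y ^ p =
      truncLap p ε u x := by
  have hm : MeasurableSet {y : EuclideanSpace ℝ (Fin n) | ε ≤ dist x y} :=
    measurableSet_le measurable_const (by fun_prop)
  rw [← integral_indicator hm, ← integral_add_left_eq_self _ x, truncLap]
  congr 1 with z
  by_cases hz : ε ≤ ‖z‖
  · simp [Set.indicator, truncKernel, hz, Real.rpow_neg, div_eq_inv_mul]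
  · simp [Set.indicator, truncKernel, hz]

lemma MemE.integrable_mul_rpow {n : ℕ} {α : ℝ} (hα : 0 < α) {u : EuclideanSpace ℝ (Fin n) → ℝ}
    (hu : MemE n α u) : Integrable fun y ↦ u y * (1 + ‖y‖) ^ (-((n : ℝ) + α)) := by
  have hp : 0 ≤ (n : ℝ) + α := by positivity
  refine (hu.2.2.const_mul 2).mono' (hu.1.continuous.mul
    (continuous_one_add_norm_rpow _)).aestronglyMeasurable (.of_forall fun y ↦ ?_)
  rw [norm_mul, Real.norm_of_nonneg (by positivity : (0 : ℝ) ≤ (1 + ‖y‖) ^ (-((n : ℝ) + α))),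
    Real.norm_eq_abs, Real.rpow_neg (by positivity), ← div_eq_mul_inv, mul_div_assoc',
    div_le_div_iff₀ (by positivity) (by positivity)]
  have h1 : 1 ≤ (1 + ‖y‖) ^ ((n : ℝ) + α) :=
    Real.one_le_rpow (by linarith [norm_nonneg y]) hp
  have h2 : ‖y‖ ^ ((n : ℝ) + α) ≤ (1 + ‖y‖) ^ ((n : ℝ) + α) := by
    gcongr
    linarith
  nlinarith [abs_nonneg (u y)]

/-- The principal value defining `fracLap` converges locally uniformly on the class `E`. -/
lemma MemE.exists_abs_fracLap_sub_le {n : ℕ} {α C : ℝ} (hα : 0 < α) (hα2 : α < 2)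
    {u : EuclideanSpace ℝ (Fin n) → ℝ} (hu : MemE n α u) (R : ℝ) :
    ∃ B, 0 ≤ B ∧ ∀ x, ‖x‖ < R → ∃ l, fracLap n α C u x = C * l ∧ ∀ ε, 0 < ε → ε ≤ 1 →
      |l - truncLap ((n : ℝ) + α) ε u x| ≤ B * ε ^ ((2 - α) / 2) := by
  obtain ⟨M, hM⟩ := hu.2.1 (R + 1)
  have hd : Module.finrank ℝ (EuclideanSpace ℝ (Fin n)) = n := finrank_euclideanSpace_fin
  have hβ : 0 < (2 - α) / 2 := by linarith
  refine ⟨M * (∫ z : EuclideanSpace ℝ (Fin n), if ‖z‖ < 1 then ‖z‖ ^ ((2 - α) / 2 -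
    Module.finrank ℝ (EuclideanSpace ℝ (Fin n))) else 0), mul_nonneg M.2 (integral_nonneg fun z ↦ by
      dsimp only; split_ifs <;> positivity), fun x hx ↦ ?_⟩
  obtain ⟨l, hl, hlε⟩ := exists_tendsto_of_abs_sub_le_rpow hβ fun ε' ε hε' hεε' hε1 ↦
    abs_truncLap_sub_le (p := (n : ℝ) + α) (by rw [hd]; linarith) hβ (by rw [hd]; ring) hε' hεε'
      hε1 M.2 hu.1.continuous (hu.integrable_mul_rpow hα) (x := x) (fderiv ℝ u x) fun z hz ↦
      abs_sub_sub_fderiv_le hu.1 hM fun y hy ↦ by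
        rw [mem_closedBall_iff_norm] at hy
        rw [mem_ball_zero_iff]
        linarith [norm_le_norm_add_norm_sub' y x]
  refine ⟨l, ?_, hlε⟩
  rw [fracLap]
  simp_rw [setIntegral_eq_truncLap]
  rw [hl.limUnder_eq]

/-- Entire solutions of the fractional Ginzburg-Landau equation take values in `[-1, 1]`. -/
lemma MemE.abs_le_one {n : ℕ} {α C : ℝ} (hα : 0 < α) (hα2 : α < 2) (hC : 0 < C)
    {u : EuclideanSpace ℝ (Fin n) → ℝ} (hu : MemE n α u)
    (heq : ∀ x, fracLap n α C u x = u x * (1 - u x ^ 2)) (x : EuclideanSpace ℝ (Fin n)) :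
    |u x| ≤ 1 := by
  have hd : Module.finrank ℝ (EuclideanSpace ℝ (Fin n)) = n := finrank_euclideanSpace_fin
  have hp : (Module.finrank ℝ (EuclideanSpace ℝ (Fin n)) : ℝ) < (n : ℝ) + α := by
    rw [hd]; linarith
  have huc := hu.1.continuous
  have hui := hu.integrable_mul_rpow hα
  set v : EuclideanSpace ℝ (Fin n) → ℝ := fun x ↦ max (|u x| - 1) 0 with hv
  have hvc : Continuous v := by fun_prop
  have hvi : Integrable fun y ↦ v y * (1 + ‖y‖) ^ (-((n : ℝ) + α)) := by
    refine hui.mono (hvc.mul (continuous_one_add_norm_rpow _)).aestronglyMeasurable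
      (.of_forall fun y ↦ ?_)
    rw [norm_mul, norm_mul]
    gcongr
    rw [Real.norm_of_nonneg (le_max_right _ _), Real.norm_eq_abs]
    exact max_le (by linarith) (abs_nonneg _)
  have hvz : v = 0 := by
    refine eq_zero_of_truncLap_le hp (β := (2 - α) / 2) (κ := 2 / C) (by linarith)
      (by rw [hd]; ring) (by positivity) hvc (fun x ↦ le_max_right _ _) hvi fun R ↦ ?_
    obtain ⟨B, hB0, hB⟩ := hu.exists_abs_fracLap_sub_le (C := C) hα hα2 R
    refine ⟨B, fun x hx ε hε hε1 ↦ ?_⟩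
    obtain ⟨l, hl, hlε⟩ := hB x hx
    have hl' := abs_le.1 (hlε ε hε hε1)
    have hBε : 0 ≤ B * ε ^ ((2 - α) / 2) := by positivity
    have hle (y) : |u y| - 1 ≤ v y := le_max_left _ _
    have hnn (y) : 0 ≤ v y := le_max_right _ _
    rw [heq] at hl
    have key (s : ℝ) := truncLap_le_mul_truncLap (s := s) hp hε huc hui hvc hvi (x := x)
    rcases le_or_gt |u x| 1 with h1 | h1
    · have hvx : v x = 0 := max_eq_right (by linarith)
      have := key 0 fun y ↦ by linarith [hnn y]
      rw [hvx]
      linarith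
    · have hvx : v x = |u x| - 1 := max_eq_left (by linarith)
      have hcubic : |u x| * (1 - |u x| ^ 2) ≤ -2 * v x := by
        rw [hvx]
        nlinarith [mul_pos (sub_pos.2 h1) (sub_pos.2 h1), abs_nonneg (u x)]
      have hdiv {a : ℝ} (ha : C * a ≤ -2 * v x) : a ≤ -(2 / C) * v x := by
        rw [neg_mul, div_mul_eq_mul_div, ← neg_div, le_div_iff₀ hC]
        linarith
      rcases le_or_gt 0 (u x) with h0 | h0
      · rw [abs_of_nonneg h0] at hvx hcubic
        have := key 1 fun y ↦ by linarith [hle y, le_abs_self (u y)]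
        have := hdiv (hl.ge.trans hcubic)
        linarith
      · rw [abs_of_neg h0] at hvx hcubic
        have := key (-1) fun y ↦ by linarith [hle y, neg_le_abs (u y)]
        have := hdiv (a := -l) (by nlinarith)
        linarith
  have := le_max_left (|u x| - 1) 0
  have hx : v x = 0 := congrFun hvz x
  simp only [hv] at hx
  linarith

theorem stmt6 (n : ℕ) (α C : ℝ) (hα : 0 < α) (hα2 : α < 2) (hC : 0 < C)
    (u : EuclideanSpace ℝ (Fin n) → ℝ) (hu : MemE n α u)
    (heq : ∀ x, fracLap n α C u x = u x * (1 - u x ^ 2)) :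
    ∀ᵐ x : EuclideanSpace ℝ (Fin n),
      fracLap n α C (fun x => max (u x ^ 2 - 1) 0) x
        ≤ -2 * (max (u x ^ 2 - 1) 0) ^ 2 := by
  have hz (x : EuclideanSpace ℝ (Fin n)) : max (u x ^ 2 - 1) 0 = 0 :=
    max_eq_right (sub_nonpos.2 ((sq_le_one_iff_abs_le_one _).2 (hu.abs_le_one hα hα2 hC heq x)))
  refine .of_forall fun x ↦ ?_
  simp [hz, fracLap, tendsto_const_nhds.limUnder_eq]
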